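/- For all real x > 0: arccot(x) + arccot(4x³ + 3x) = 2·arccot(2x), where arccot(t) = π/2 - arctan(t). -/

import Mathlib

noncomputable def arccot (t : ℝ) : ℝ := Real.pi / 2 - Real.arctan t

theorem arctan_sub_arctan {a b : ℝ} (h : -1 < a * b) :
    Real.arctan a - Real.arctan b = Real.arctan ((a - b) / (1 + a * b)) := by
  have key := Real.arctan_add (x := a) (y := -b) (by linarith)
  rw [Real.arctan_neg] at key
  rw [sub_eq_add_neg, key]
  congr 2
  ring

theorem stmt_10 (x : ℝ) (hx : 0 < x) :
    arccot x + arccot (4 * x ^ 3 + 3 * x) = 2 * arccot (2 * x) := by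
  have h₁ := arctan_sub_arctan (a := 2 * x) (b := x) (neg_one_lt_zero.trans (by positivity))
  have h₂ := arctan_sub_arctan (a := 4 * x ^ 3 + 3 * x) (b := 2 * x)
    (neg_one_lt_zero.trans (by positivity))
  have h₃ : (4 * x ^ 3 + 3 * x - 2 * x) / (1 + (4 * x ^ 3 + 3 * x) * (2 * x)) =
      (2 * x - x) / (1 + 2 * x * x) := by
    rw [div_eq_div_iff (by positivity) (by positivity)]
    ring
  rw [h₃] at h₂
  unfold arccot
  linarith
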